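/- Let G' = ℤ/2 × ℤ/2 × ℤ/2 × ℤ (elements (x,z,t,n)) with homomorphism φ'(x,z,t,n) = t, and let χ : ℤ/2 → Circle be the homomorphism with χ(0) = 1, χ(1) = −1. Then the function ω₀ : G'×G'×G' → Circle defined by ω₀((x₁,z₁,t₁,n₁),(x₂,z₂,t₂,n₂),(x₃,z₃,t₃,n₃)) = χ((x₁·z₂ + t₁·t₂)·n̄₃), where n̄₃ denotes n₃ mod 2, is a twisted 3-cocycle with respect to φ'. -/

import Mathlib

/-- The element `-1` of the circle group. -/
noncomputable def negOne : Circle := ⟨-1, by simp [Submonoid.unitSphere]⟩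

/-- The homomorphism `χ : ℤ/2 → Circle` with `χ 0 = 1` and `χ 1 = -1`. -/
noncomputable def chi (t : ZMod 2) : Circle := if t = 0 then 1 else negOne

/-- The action of `g : G` on the circle group determined by a homomorphism
`φ : G → ℤ/2`: trivially if `φ g = 0`, by complex conjugation (inversion) if `φ g = 1`. -/
noncomputable def circAct {G : Type*} (φ : G → ZMod 2) (g : G) (z : Circle) : Circle :=
  if φ g = 0 then z else z⁻¹

/-- `ω : G×G×G → Circle` is a twisted 3-cocycle with respect to `φ : G → ℤ/2`. -/
def IsTwisted3Cocycle {G : Type*} [Group G] (φ : G → ZMod 2)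
    (ω : G → G → G → Circle) : Prop :=
  ∀ g h k l : G,
    circAct φ g (ω h k l) * ω g h k * ω g (h * k) l = ω (g * h) k l * ω g h (k * l)

/-- The group `G' = ℤ/2 × ℤ/2 × ℤ/2 × ℤ` (written multiplicatively), with elements
`(x, z, t, n)`. -/
abbrev GXZTT : Type := Multiplicative (ZMod 2 × ZMod 2 × ZMod 2 × ℤ)

/-- The homomorphism `φ'(x,z,t,n) = t` on `ℤ/2 × ℤ/2 × ℤ/2 × ℤ`. -/
def phiXZTT (g : GXZTT) : ZMod 2 := (Multiplicative.toAdd g).2.2.1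

/-- The anomaly 3-cocycle
`ω₀((x₁,z₁,t₁,n₁),(x₂,z₂,t₂,n₂),(x₃,z₃,t₃,n₃)) = (-1)^{(x₁z₂+t₁t₂)n̄₃}` of the
spin-1/2 chain with on-site symmetry `ℤ₂ˣ × ℤ₂ᶻ × ℤ₂ᵀ` and unitary translation. -/
noncomputable def omegaXZTT (g₁ g₂ g₃ : GXZTT) : Circle :=
  chi (((Multiplicative.toAdd g₁).1 * (Multiplicative.toAdd g₂).2.1 +
        (Multiplicative.toAdd g₁).2.2.1 * (Multiplicative.toAdd g₂).2.2.1) *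
      (((Multiplicative.toAdd g₃).2.2.2 : ℤ) : ZMod 2))

theorem negOne_mul_self : negOne * negOne = 1 := by
  ext
  rw [Circle.coe_mul]
  change (-1 : ℂ) * -1 = 1
  norm_num

theorem chi_add (a b : ZMod 2) : chi (a + b) = chi a * chi b := by
  have chi_zero : chi 0 = 1 := if_pos rfl
  have chi_one : chi 1 = negOne := if_neg one_ne_zero
  have cases_zmod_two : ∀ c : ZMod 2, c = 0 ∨ c = 1 := by decide
  obtain rfl | rfl := cases_zmod_two a <;> obtain rfl | rfl := cases_zmod_two b <;>
    simp [chi_zero, chi_one, negOne_mul_self, CharTwo.add_self_eq_zero]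

theorem chi_inv (a : ZMod 2) : (chi a)⁻¹ = chi a := by
  rw [inv_eq_iff_mul_eq_one, ← chi_add, CharTwo.add_self_eq_zero]
  simp [chi]

theorem circAct_chi {G : Type*} (φ : G → ZMod 2) (g : G) (a : ZMod 2) :
    circAct φ g (chi a) = chi a := by
  simp [circAct, chi_inv]

/-- **The anomaly index `(-1)^{(x₁z₂+t₁t₂)n₃}` is a twisted 3-cocycle** with respect to
`φ'(x,z,t,n) = t`. -/
theorem omegaXZTT_isTwisted3Cocycle : IsTwisted3Cocycle phiXZTT omegaXZTT := by
  intro g h k l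
  simp only [omegaXZTT, circAct_chi, ← chi_add, toAdd_mul, Prod.fst_add, Prod.snd_add,
    Int.cast_add]
  congr 1
  ring
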